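/- Suppose the family of chains X^{(a)} satisfies the 0^ℓ-SD condition. Then Var(T^a_0 / E[T^a_0]) → 0 as a → ∞; consequently the family of hitting times T^a_0 exhibits cut-off behavior at mean times, i.e. T^a_0 / E[T^a_0] → 1 in probability as a → ∞. -/

import Mathlib

open MeasureTheory ProbabilityTheory Filter Topology ENNReal

noncomputable section

/-- A discrete-time birth-and-death chain on a countable rooted tree `I`.
The tree is encoded by a root, a parent map and a depth function; the chain is
encoded by its transition matrix `P` (nonzero only between tree-neighbours and
on the diagonal) and by the laws `law x` of the trajectories started at `x`,
characterised by the cylinder formula.  `invm` is the reversible invariant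
probability measure of the chain (positive recurrence). -/
structure TreeChain (I : Type*) [MeasurableSpace I] where
  root : I
  par : I → I
  depth : I → ℕ
  par_root : par root = root
  depth_root : depth root = 0
  depth_eq_zero : ∀ x, depth x = 0 → x = root
  depth_par : ∀ x, x ≠ root → depth x = depth (par x) + 1
  P : I → I → ℝ≥0∞
  P_row : ∀ x, ∑' y, P x y = 1
  P_support : ∀ x y, P x y ≠ 0 → y = x ∨ y = par x ∨ x = par y
  lam_pos : ∀ x, x ≠ root → P (par x) x ≠ 0
  mu_pos : ∀ x, x ≠ root → P x (par x) ≠ 0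
  law : I → Measure (ℕ → I)
  law_prob : ∀ x, IsProbabilityMeasure (law x)
  law_start : ∀ x, law x {ω | ω 0 = x} = 1
  law_cyl : ∀ x (n : ℕ) (γ : ℕ → I), γ 0 = x →
    law x {ω | ∀ i ≤ n, ω i = γ i} = ∏ i ∈ Finset.range n, P (γ i) (γ (i + 1))
  invm : I → ℝ≥0∞
  invm_pos : ∀ x, invm x ≠ 0
  invm_sum : ∑' x, invm x = 1
  invm_rev : ∀ x y, invm x * P x y = invm y * P y x

/-- The hitting time of `y`, as an extended nonnegative real (`∞` if `y` is never hit). -/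
def hitTime {I : Type*} (y : I) (ω : ℕ → I) : ℝ≥0∞ :=
  ⨅ (t : ℕ) (_ : ω t = y), (t : ℝ≥0∞)

namespace TreeChain

variable {I : Type*} [MeasurableSpace I] (c : TreeChain I)

/-- The branch `B_x` stemming from `x`: the set of descendants of `x` (including `x`). -/
def branch (x : I) : Set I := {y | ∃ n, c.par^[n] y = x}

/-- The set `ℓ(x)` of vertices on the path from `x` to the root, the root excluded. -/
def pathToRoot (x : I) : Set I := {y | ∃ i < c.depth x, c.par^[i] x = y}

/-- The set `σ(x)` of children of `x`. -/
def children (x : I) : Set I := {y | y ≠ c.root ∧ c.par y = x}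

/-- `μ_x`, the transition probability from `x` to its parent. -/
def mu (x : I) : ℝ≥0∞ := c.P x (c.par x)

/-- `λ_x`, the transition probability from the parent of `x` to `x`. -/
def lamP (x : I) : ℝ≥0∞ := c.P (c.par x) x

/-- `π(A)`, the invariant mass of a set of vertices. -/
def piSet (A : Set I) : ℝ≥0∞ := ∑' y : A, c.invm (y : I)

/-- `E[T^x_y]`, the expected hitting time of `y` for the chain started at `x`. -/
def ET (x y : I) : ℝ≥0∞ := ∫⁻ ω, hitTime y ω ∂(c.law x)

/-- `E[(T^x_y)²]`, the second moment of the hitting time of `y` started at `x`. -/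
def ET2 (x y : I) : ℝ≥0∞ := ∫⁻ ω, (hitTime y ω) ^ 2 ∂(c.law x)

/-- The normalised hitting time `T^x_y / E[T^x_y]` as a real random variable. -/
def ratio (x y : I) (ω : ℕ → I) : ℝ := (hitTime y ω).toReal / (c.ET x y).toReal

/-- `α(a)`: the child of the root lying on the path from `a` to the root. -/
def alphaVert (a : I) : I := c.par^[c.depth a - 1] a

/-- The drift constant `K_a = sup_{b ∈ B_{α(a)}} μ_b · E[T^b_{p(b)}]`. -/
def Kdrift (a : I) : ℝ≥0∞ :=
  ⨆ b ∈ c.branch (c.alphaVert a), c.mu b * c.ET b (c.par b)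

/-- The global constant `K'_a = sup_{b ∈ I} μ_b · E[T^b_{p(b)}]`. -/
def Kdrift' : ℝ≥0∞ := ⨆ b : I, c.mu b * c.ET b (c.par b)

/-- The quantity `Q_x = π(B_x)⁻¹ · Σ_{b ∈ B_x} π(B_b)²/(μ_b π(b))`. -/
def Qx (x : I) : ℝ≥0∞ :=
  (c.piSet (c.branch x))⁻¹ *
    ∑' b : c.branch x, (c.piSet (c.branch (b : I))) ^ 2 / (c.mu (b : I) * c.invm (b : I))

/-- `Q_a = sup_{x ∈ ℓ(a)} Q_x`. -/
def Qsup (a : I) : ℝ≥0∞ := ⨆ x ∈ c.pathToRoot a, c.Qx x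

/-- `R_a = Σ_{b ∈ ℓ(a)} π(B_b)²/(μ_b π(b))`. -/
def Rsum (a : I) : ℝ≥0∞ :=
  ∑' b : c.pathToRoot a, (c.piSet (c.branch (b : I))) ^ 2 / (c.mu (b : I) * c.invm (b : I))

/-- The set `C_{a,k}`: union over the vertices `a_l`, `k < l ≤ d(a)`, of the path from
`a_k` to the root, of the branches stemming from the children of `a_l` other
than `a_{l-1}`. -/
def Cset (a : I) (k : ℕ) : Set I :=
  {y | ∃ l, k + 1 ≤ l ∧ l ≤ c.depth a ∧
    ∃ ch, ch ∈ c.children (c.par^[l] a) ∧ ch ≠ c.par^[l - 1] a ∧ y ∈ c.branch ch}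

end TreeChain

/-- The strong drift condition `0^ℓ-SD` toward the root, for a family of chains
`c n` with distinguished vertices `a n` (the limit `a → ∞` being `n → ∞`). -/
def StrongDrift {I : ℕ → Type*} [∀ n, MeasurableSpace (I n)]
    (c : ∀ n, TreeChain (I n)) (a : ∀ n, I n) : Prop :=
  (∃ Kmu : ℝ≥0∞, 0 < Kmu ∧
      ∀ n, ∀ b ∈ (c n).branch ((c n).alphaVert (a n)), Kmu ≤ (c n).mu b) ∧
  Tendsto (fun n => ((c n).Kdrift (a n)) ^ 2 / (c n).ET (a n) (c n).root) atTop (𝓝 0)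


/-- Two points of a product space whose coordinates are not separated by measurable sets are
not separated by any measurable set of the product. -/
theorem mem_iff_mem_of_forall_coord {ι : Type*} {E : Type*} [MeasurableSpace E]
    {ω ω' : ι → E} (h : ∀ i, ∀ s : Set E, MeasurableSet s → (ω i ∈ s ↔ ω' i ∈ s))
    {M : Set (ι → E)} (hM : MeasurableSet M) : ω ∈ M ↔ ω' ∈ M := by
  let g : Bool → ι → E := fun b => if b then ω else ω'
  have hg : @Measurable Bool (ι → E) ⊥ _ g := by
    let _ : MeasurableSpace Bool := ⊥
    refine measurable_pi_iff.2 fun i s hs => ?_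
    rw [MeasurableSpace.measurableSet_bot_iff]
    by_cases hi : ω' i ∈ s
    · right
      ext b
      cases b <;> simp [g, hi, (h i s hs)]
    · left
      ext b
      cases b <;> simp [g, hi, (h i s hs)]
  have := hg hM
  rw [MeasurableSpace.measurableSet_bot_iff] at this
  rcases this with h0 | h0
  · have h1 : true ∉ g ⁻¹' M := by simp [h0]
    have h2 : false ∉ g ⁻¹' M := by simp [h0]
    simp only [Set.mem_preimage, g] at h1 h2
    simp_all
  · have h1 : true ∈ g ⁻¹' M := by simp [h0]
    have h2 : false ∈ g ⁻¹' M := by simp [h0]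
    simp only [Set.mem_preimage, g] at h1 h2
    simp_all

section HitTime

variable {I : Type*}

theorem hitTime_eq_of_isLeast {z : I} {ω : ℕ → I} {k : ℕ} (hk : IsLeast {t | ω t = z} k) :
    hitTime z ω = k := by
  refine le_antisymm (iInf₂_le k hk.1) (le_iInf₂ fun t ht => ?_)
  exact_mod_cast hk.2 ht

theorem forall_le_ne_iff_lt {z : I} {ω : ℕ → I} {k n : ℕ} (hk : IsLeast {t | ω t = z} k) :
    (∀ i ≤ n, ω i ≠ z) ↔ n < k := by
  constructor
  · intro h
    by_contra hn
    exact h k (not_lt.1 hn) hk.1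
  · intro h i hi he
    exact absurd (hk.2 he) (by omega)

theorem hitTime_eq_top {z : I} {ω : ℕ → I} (h : ∀ t, ω t ≠ z) : hitTime z ω = ⊤ := by
  simp [hitTime, h]

theorem tsum_survival_weight {z : I} {ω : ℕ → I} {k : ℕ} (hk : IsLeast {t | ω t = z} k)
    (f : ℕ → ℝ≥0∞) :
    ∑' n, f n * {ω : ℕ → I | ∀ i ≤ n, ω i ≠ z}.indicator 1 ω = ∑ n ∈ Finset.range k, f n := by
  rw [tsum_eq_sum (s := Finset.range k)]
  · refine Finset.sum_congr rfl fun n hn => ?_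
    rw [Set.indicator_of_mem]
    · simp
    · exact (forall_le_ne_iff_lt hk).2 (Finset.mem_range.1 hn)
  · intro n hn
    rw [Set.indicator_of_notMem]
    · simp
    · exact fun h => hn (Finset.mem_range.2 ((forall_le_ne_iff_lt hk).1 h))

theorem exists_isLeast_hit {z : I} {ω : ℕ → I} (h : ∃ t, ω t = z) :
    ∃ k, IsLeast {t | ω t = z} k := by
  classical
  exact ⟨Nat.find h, Nat.find_spec h, fun t ht => Nat.find_min' h ht⟩

theorem hitTime_eq_tsum (z : I) (ω : ℕ → I) :
    hitTime z ω = ∑' n : ℕ, 1 * {ω : ℕ → I | ∀ i ≤ n, ω i ≠ z}.indicator 1 ω := by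
  by_cases h : ∃ t, ω t = z
  · obtain ⟨k, hk⟩ := exists_isLeast_hit h
    rw [hitTime_eq_of_isLeast hk, tsum_survival_weight hk (fun _ => 1)]
    simp
  · push Not at h
    rw [hitTime_eq_top h]
    simp [Set.indicator, h]

theorem hitTime_sq_eq_tsum (z : I) (ω : ℕ → I) :
    hitTime z ω ^ 2 =
      ∑' n : ℕ, (2 * n + 1 : ℝ≥0∞) * {ω : ℕ → I | ∀ i ≤ n, ω i ≠ z}.indicator 1 ω := by
  by_cases h : ∃ t, ω t = z
  · obtain ⟨k, hk⟩ := exists_isLeast_hit h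
    rw [hitTime_eq_of_isLeast hk, tsum_survival_weight hk (fun n => 2 * n + 1)]
    clear hk
    induction k with
    | zero => simp
    | succ k ih =>
      rw [Finset.sum_range_succ, ← ih]
      push_cast
      ring
  · push Not at h
    rw [hitTime_eq_top h, eq_comm, ENNReal.top_pow two_ne_zero, eq_top_iff]
    calc (⊤ : ℝ≥0∞) = ∑' _ : ℕ, 1 := (ENNReal.tsum_const_eq_top_of_ne_zero one_ne_zero).symm
      _ ≤ _ := ENNReal.tsum_le_tsum fun n => by simp [Set.indicator, h]

end HitTime

namespace TreeChain

variable {I : Type*} [MeasurableSpace I] (c : TreeChain I)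

/-- The cylinder formula forces the `σ`-algebra to separate the vertices: an atom with two points
would give a one-step transition mass larger than `1`. -/
theorem exists_measurableSet_separating [Countable I] {w z : I} (hw : w ≠ c.root) (hzw : z ≠ w) :
    ∃ s, MeasurableSet s ∧ ¬ (w ∈ s ↔ z ∈ s) := by
  by_contra! hsep
  set x := c.par w
  have := c.law_prob x
  have hcyl : ∀ y, c.law x {ω | ω 0 = x ∧ ω 1 = y} = c.P x y := by
    intro y
    have := c.law_cyl x 1 (fun i => if i = 0 then x else y) (by simp)
    simp only [Finset.range_one, Finset.prod_singleton] at this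
    simp only [if_true, Nat.zero_add, one_ne_zero, if_false] at this
    rw [← this]
    congr 1
    ext ω
    constructor
    · rintro ⟨h0, h1⟩ i hi
      interval_cases i <;> simp [h0, h1]
    · intro h
      exact ⟨by simpa using h 0 (by simp), by simpa using h 1 le_rfl⟩
  set A : Set (ℕ → I) := ⋃ y : {y // y ≠ w}, {ω | ω 0 = x ∧ ω 1 = y}
  have hA : c.law x A ≤ ∑' y : {y // y ≠ w}, c.P x y :=
    (measure_iUnion_le _).trans_eq (tsum_congr fun y => hcyl y)
  have hsub : {ω | ω 0 = x} ⊆ toMeasurable (c.law x) A := by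
    intro ω hω
    by_cases h1 : ω 1 = w
    · have hmem : Function.update ω 1 z ∈ A := by
        refine Set.mem_iUnion.2 ⟨⟨z, hzw⟩, ?_⟩
        simpa using hω
      refine (mem_iff_mem_of_forall_coord (fun i s hs => ?_)
        (measurableSet_toMeasurable _ _)).2 (subset_toMeasurable _ _ hmem)
      by_cases hi : i = 1
      · subst hi
        simpa [h1] using hsep s hs
      · simp [hi]
    · exact subset_toMeasurable _ _ (Set.mem_iUnion.2 ⟨⟨ω 1, h1⟩, hω, rfl⟩)
  have h1 : (1 : ℝ≥0∞) ≤ ∑' y : {y // y ≠ w}, c.P x y := by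
    rw [← c.law_start x]
    exact (measure_mono hsub).trans ((measure_toMeasurable A).trans_le hA)
  have hsum : c.P x w + ∑' y : {y // y ≠ w}, c.P x y = 1 := by
    rw [← c.P_row x, ← ENNReal.summable.tsum_add_tsum_compl (s := {w}) ENNReal.summable]
    congr 1
    simp
  have hlt : (1 : ℝ≥0∞) < c.P x w + ∑' y : {y // y ≠ w}, c.P x y :=
    lt_of_lt_of_le (by
      rw [add_comm]
      exact ENNReal.lt_add_right ENNReal.one_ne_top (c.lam_pos w hw)) (add_le_add_right h1 _)
  exact hlt.ne' hsum

theorem measurableSingletonClass {I : Type*} [MeasurableSpace I] [Countable I] (c : TreeChain I) :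
    MeasurableSingletonClass I := by
  have hne : ∀ w, w ≠ c.root → MeasurableSet {w} := by
    intro w hw
    have : ∀ z : {z // z ≠ w}, ∃ s, MeasurableSet s ∧ w ∈ s ∧ (z : I) ∉ s := by
      rintro ⟨z, hz⟩
      obtain ⟨s, hs, hsep⟩ := c.exists_measurableSet_separating hw hz
      by_cases hws : w ∈ s
      · exact ⟨s, hs, hws, fun h => hsep (by simp [hws, h])⟩
      · exact ⟨sᶜ, hs.compl, hws, fun h => hsep (by simpa [hws] using h)⟩
    choose s hs hws hzs using this
    have heq : {w} = ⋂ z, s z := by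
      ext y
      simp only [Set.mem_singleton_iff, Set.mem_iInter]
      constructor
      · rintro rfl z
        exact hws z
      · intro h
        by_contra hy
        exact hzs ⟨y, hy⟩ (h _)
    rw [heq]
    exact MeasurableSet.iInter hs
  refine ⟨fun w => ?_⟩
  by_cases hw : w = c.root
  · have heq : {w} = (⋃ y : {y // y ≠ c.root}, {(y : I)})ᶜ := by
      ext y
      simp [hw]
    rw [heq]
    exact (MeasurableSet.iUnion fun y : {y // y ≠ c.root} => hne y y.2).compl
  · exact hne w hw

open Classical in
/-- The probability that the chain started at `x` does not visit `z` up to time `n`,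
defined by first-step analysis. -/
def surv (z : I) : ℕ → I → ℝ≥0∞
  | 0, x => if x = z then 0 else 1
  | n + 1, x => if x = z then 0 else ∑' y, c.P x y * surv z n y

theorem surv_self (z : I) (n : ℕ) : c.surv z n z = 0 := by
  cases n <;> simp [surv]

theorem surv_zero {z x : I} (h : x ≠ z) : c.surv z 0 x = 1 := by simp [surv, h]

theorem surv_succ {z x : I} (h : x ≠ z) (n : ℕ) :
    c.surv z (n + 1) x = ∑' y, c.P x y * c.surv z n y := by simp [surv, h]

theorem measurableSet_coord [Countable I] [MeasurableSingletonClass I] (i : ℕ) (p : I → Prop) :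
    MeasurableSet {ω : ℕ → I | p (ω i)} :=
  measurableSet_setOfPred.2 ((Measurable.of_discrete (f := p)).comp (measurable_pi_apply i))

theorem measurableSet_avoid [Countable I] [MeasurableSingletonClass I] (z : I) (m n : ℕ) :
    MeasurableSet {ω : ℕ → I | ∀ i ≤ n, ω (m + i) ≠ z} := by
  simp only [Set.ofPred_forall]
  refine MeasurableSet.iInter fun i => MeasurableSet.iInter fun _ => ?_
  exact measurableSet_coord _ (· ≠ z)

theorem measurableSet_cylinder [Countable I] [MeasurableSingletonClass I] (γ : ℕ → I) (n : ℕ) :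
    MeasurableSet {ω : ℕ → I | ∀ i ≤ n, ω i = γ i} := by
  simp only [Set.ofPred_forall]
  refine MeasurableSet.iInter fun i => MeasurableSet.iInter fun _ => ?_
  exact measurableSet_coord _ (· = γ i)

/-- Markov property at time `m` for the event of avoiding `z` during the next `n` steps. -/
theorem law_cylinder_inter_avoid [Countable I] [MeasurableSingletonClass I] (x z : I) (n m : ℕ)
    (γ : ℕ → I) (hγ : γ 0 = x) :
    c.law x ({ω | ∀ i ≤ m, ω i = γ i} ∩ {ω | ∀ i ≤ n, ω (m + i) ≠ z}) =
      (∏ i ∈ Finset.range m, c.P (γ i) (γ (i + 1))) * c.surv z n (γ m) := by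
  induction n generalizing m γ with
  | zero =>
    by_cases h : γ m = z
    · rw [h, surv_self, mul_zero]
      convert measure_empty (μ := c.law x)
      ext ω
      simp only [Set.mem_inter_iff, Set.mem_ofPred_eq, Set.mem_empty_iff_false, iff_false, not_and]
      intro h1 h2
      exact h2 0 le_rfl ((h1 m le_rfl).trans h)
    · rw [surv_zero c h, mul_one, ← c.law_cyl x m γ hγ]
      congr 1
      ext ω
      simp only [Set.mem_inter_iff, Set.mem_ofPred_eq, and_iff_left_iff_imp]
      intro h1 i hi
      obtain rfl : i = 0 := by omega
      rw [add_zero, h1 m le_rfl]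
      exact h
  | succ n ih =>
    by_cases h : γ m = z
    · rw [h, surv_self, mul_zero]
      convert measure_empty (μ := c.law x)
      ext ω
      simp only [Set.mem_inter_iff, Set.mem_ofPred_eq, Set.mem_empty_iff_false, iff_false, not_and]
      intro h1 h2
      exact h2 0 (by omega) ((h1 m le_rfl).trans h)
    · have hup : ∀ y, ∀ i ≤ m, Function.update γ (m + 1) y i = γ i := fun y i hi =>
        Function.update_of_ne (by omega) _ _
      have hset : {ω : ℕ → I | ∀ i ≤ m, ω i = γ i} ∩ {ω | ∀ i ≤ n + 1, ω (m + i) ≠ z} =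
          ⋃ y, ({ω | ∀ i ≤ m + 1, ω i = Function.update γ (m + 1) y i} ∩
            {ω | ∀ i ≤ n, ω (m + 1 + i) ≠ z}) := by
        ext ω
        simp only [Set.mem_inter_iff, Set.mem_ofPred_eq, Set.mem_iUnion]
        constructor
        · rintro ⟨h1, h2⟩
          refine ⟨ω (m + 1), fun i hi => ?_, fun i hi => ?_⟩
          · rcases Nat.le_succ_iff.1 hi with hi | rfl
            · rw [hup _ i hi, h1 i hi]
            · simp
          · have := h2 (i + 1) (by omega)
            rwa [show m + 1 + i = m + (i + 1) by omega]
        · rintro ⟨y, h1, h2⟩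
          have h1' : ∀ i ≤ m, ω i = γ i := fun i hi => by rw [h1 i (by omega), hup _ i hi]
          refine ⟨h1', fun i hi => ?_⟩
          rcases i with _ | i
          · rw [add_zero, h1' m le_rfl]
            exact h
          · have := h2 i (by omega)
            rwa [show m + 1 + i = m + (i + 1) by omega] at this
      rw [hset, measure_iUnion]
      · rw [surv_succ c h, ← ENNReal.tsum_mul_left]
        refine tsum_congr fun y => ?_
        rw [ih (m + 1) _ (by rw [hup _ 0 (Nat.zero_le _), hγ]), Finset.prod_range_succ,
          hup _ m le_rfl, Function.update_self, mul_assoc]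
        congr 1
        refine Finset.prod_congr rfl fun i hi => ?_
        have := Finset.mem_range.1 hi
        rw [hup _ i (by omega), hup _ (i + 1) (by omega)]
      · intro y y' hyy'
        refine Set.disjoint_left.2 fun ω h1 h2 => hyy' ?_
        have e1 := h1.1 (m + 1) le_rfl
        have e2 := h2.1 (m + 1) le_rfl
        rw [Function.update_self] at e1 e2
        exact e1.symm.trans e2
      · exact fun y => (measurableSet_cylinder _ _).inter (measurableSet_avoid _ _ _)

theorem law_avoid [Countable I] [MeasurableSingletonClass I] (x z : I) (n : ℕ) :
    c.law x {ω | ∀ i ≤ n, ω i ≠ z} = c.surv z n x := by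
  have := c.law_prob x
  have h := c.law_cylinder_inter_avoid x z n 0 (fun _ => x) rfl
  simp only [Finset.range_zero, Finset.prod_empty, one_mul, zero_add] at h
  rw [← h]
  refine measure_congr ?_
  have hm : MeasurableSet {ω : ℕ → I | ω 0 = x} :=
    measurableSet_coord _ (· = x)
  have h0 : ∀ᵐ ω ∂c.law x, ω 0 = x := by
    have := (prob_compl_eq_zero_iff hm).2 (c.law_start x)
    exact this
  filter_upwards [h0] with ω hω
  refine propext ?_
  change (∀ i ≤ n, ω i ≠ z) ↔ _
  constructor
  · intro h1
    refine ⟨fun i hi => ?_, h1⟩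
    obtain rfl : i = 0 := by omega
    exact hω
  · exact fun h1 => h1.2

theorem lintegral_survival_weight [Countable I] [MeasurableSingletonClass I] (x z : I)
    (f : ℕ → ℝ≥0∞) :
    ∫⁻ ω, ∑' n, f n * {ω : ℕ → I | ∀ i ≤ n, ω i ≠ z}.indicator 1 ω ∂c.law x =
      ∑' n, f n * c.surv z n x := by
  have hm : ∀ n, MeasurableSet {ω : ℕ → I | ∀ i ≤ n, ω i ≠ z} := fun n => by
    simpa using measurableSet_avoid z 0 n
  rw [lintegral_tsum fun n => ((measurable_one.indicator (hm n)).const_mul _).aemeasurable]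
  refine tsum_congr fun n => ?_
  rw [lintegral_const_mul _ (measurable_one.indicator (hm n)), lintegral_indicator_one (hm n),
    law_avoid]

theorem ET_eq_tsum [Countable I] [MeasurableSingletonClass I] (x z : I) :
    c.ET x z = ∑' n, c.surv z n x := by
  simp only [ET, hitTime_eq_tsum]
  rw [lintegral_survival_weight c x z (fun _ => 1)]
  simp

theorem ET2_eq_tsum [Countable I] [MeasurableSingletonClass I] (x z : I) :
    c.ET2 x z = ∑' n : ℕ, (2 * n + 1) * c.surv z n x := by
  simp only [ET2, hitTime_sq_eq_tsum]
  rw [lintegral_survival_weight c x z (fun n => 2 * n + 1)]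

theorem measurable_hitTime [Countable I] [MeasurableSingletonClass I] (z : I) :
    Measurable (hitTime z : (ℕ → I) → ℝ≥0∞) := by
  have : (hitTime z : (ℕ → I) → ℝ≥0∞) = fun ω => ∑' n : ℕ,
      1 * {ω : ℕ → I | ∀ i ≤ n, ω i ≠ z}.indicator 1 ω := funext (hitTime_eq_tsum z)
  rw [this]
  refine Measurable.tsum fun n => Measurable.const_mul (measurable_one.indicator ?_) _
  simpa using measurableSet_avoid z 0 n

theorem tsum_P_mul_const (x : I) (r : ℝ≥0∞) : ∑' y, c.P x y * r = r := by
  rw [ENNReal.tsum_mul_right, c.P_row, one_mul]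

theorem sum_mul_surv_succ {x z : I} (h : x ≠ z) (f : ℕ → ℝ≥0∞) (N : ℕ) :
    ∑ n ∈ Finset.range N, f n * c.surv z (n + 1) x =
      ∑' y, c.P x y * ∑ n ∈ Finset.range N, f n * c.surv z n y := by
  simp_rw [surv_succ c h, Finset.mul_sum, ← ENNReal.tsum_mul_left]
  rw [Summable.tsum_finsetSum fun _ _ => ENNReal.summable]
  exact Finset.sum_congr rfl fun n _ => tsum_congr fun y => by ring

theorem ET_ne_top_of_tsum_ne_top {x y z : I} (h : ∑' y, c.P x y * c.ET y z ≠ ⊤)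
    (hP : c.P x y ≠ 0) : c.ET y z ≠ ⊤ := by
  intro htop
  refine h (eq_top_iff.2 ((le_of_eq ?_).trans (ENNReal.le_tsum y)))
  rw [htop, ENNReal.mul_top hP]

theorem mem_branch_self (x : I) : x ∈ c.branch x := ⟨0, rfl⟩

theorem iterate_par_root (n : ℕ) : c.par^[n] c.root = c.root :=
  Function.iterate_fixed c.par_root n

theorem ne_root_of_mem_branch {x y : I} (hx : x ≠ c.root) (hy : y ∈ c.branch x) :
    y ≠ c.root := by
  rintro rfl
  obtain ⟨n, hn⟩ := hy
  exact hx (hn.symm.trans (c.iterate_par_root n))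

theorem mem_branch_of_par_mem {x y : I} (h : c.par y ∈ c.branch x) : y ∈ c.branch x := by
  obtain ⟨n, hn⟩ := h
  exact ⟨n + 1, by rwa [Function.iterate_succ_apply]⟩

theorem par_mem_branch {x y : I} (h : y ∈ c.branch x) (hne : y ≠ x) : c.par y ∈ c.branch x := by
  obtain ⟨n, hn⟩ := h
  cases n with
  | zero => exact absurd hn hne
  | succ n => exact ⟨n, by rwa [Function.iterate_succ_apply] at hn⟩

theorem mem_branch_or_eq_par_of_P_ne_zero {x y y' : I} (hy : y ∈ c.branch x)
    (hP : c.P y y' ≠ 0) : y' ∈ c.branch x ∨ y' = c.par x := by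
  rcases c.P_support y y' hP with rfl | rfl | rfl
  · exact Or.inl hy
  · by_cases h : y = x
    · exact Or.inr (by rw [h])
    · exact Or.inl (c.par_mem_branch hy h)
  · exact Or.inl (c.mem_branch_of_par_mem hy)

theorem depth_iterate_par (x : I) (n : ℕ) : c.depth (c.par^[n] x) = c.depth x - n := by
  induction n with
  | zero => rfl
  | succ n ih =>
    rw [Function.iterate_succ_apply']
    by_cases h : c.par^[n] x = c.root
    · rw [h, c.depth_root] at ih
      rw [h, c.par_root, c.depth_root]
      omega
    · have := c.depth_par _ h
      omega

theorem depth_alphaVert {a : I} (ha : 1 ≤ c.depth a) : c.depth (c.alphaVert a) = 1 := by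
  rw [alphaVert, depth_iterate_par]
  omega

theorem mu_le_one (x : I) : c.mu x ≤ 1 := by
  rw [← c.P_row x]
  exact ENNReal.le_tsum _

section FirstStep

variable [Countable I] [MeasurableSingletonClass I]

theorem ET_self (z : I) : c.ET z z = 0 := by
  simp [ET_eq_tsum, surv_self]

theorem ET_eq_one_add {x z : I} (h : x ≠ z) : c.ET x z = 1 + ∑' y, c.P x y * c.ET y z := by
  rw [ET_eq_tsum, tsum_eq_zero_add' ENNReal.summable, surv_zero c h]
  simp_rw [surv_succ c h, ET_eq_tsum, ← ENNReal.tsum_mul_left]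
  rw [ENNReal.tsum_comm]

theorem surv_le_one (z : I) (n : ℕ) (x : I) : c.surv z n x ≤ 1 := by
  have := c.law_prob x
  rw [← law_avoid]
  exact prob_le_one

theorem surv_succ_le (z : I) (n : ℕ) (x : I) : c.surv z (n + 1) x ≤ c.surv z n x := by
  rw [← law_avoid, ← law_avoid]
  exact measure_mono fun ω h i hi => h i (by omega)

/-- The expected hitting time is dominated by every supersolution of the first-step equation. -/
theorem ET_le_of_supersolution {z : I} {u : I → ℝ≥0∞}
    (hu : ∀ x, x ≠ z → 1 + ∑' y, c.P x y * u y ≤ u x) (x : I) : c.ET x z ≤ u x := by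
  rw [ET_eq_tsum]
  refine ENNReal.tsum_le_of_sum_range_le fun N => ?_
  induction N generalizing x with
  | zero => simp
  | succ N ih =>
    by_cases h : x = z
    · simp [h, surv_self]
    · rw [Finset.sum_range_succ', surv_zero c h, add_comm]
      have := c.sum_mul_surv_succ h (fun _ => 1) N
      simp only [one_mul] at this
      rw [this]
      refine le_trans ?_ (hu x h)
      gcongr with y
      exact ih y

/-- The second moment of the hitting time is dominated by every supersolution of the
corresponding first-step equation. -/
theorem ET2_le_of_supersolution {z : I} {u : I → ℝ≥0∞}
    (hu : ∀ x, x ≠ z → 1 + ∑' y, c.P x y * (u y + 2 * c.ET y z) ≤ u x) (x : I) :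
    c.ET2 x z ≤ u x := by
  rw [ET2_eq_tsum]
  refine ENNReal.tsum_le_of_sum_range_le fun N => ?_
  induction N generalizing x with
  | zero => simp
  | succ N ih =>
    by_cases h : x = z
    · simp [h, surv_self]
    · rw [Finset.sum_range_succ', surv_zero c h, add_comm]
      have hs := c.sum_mul_surv_succ h (fun n => 2 * ((n + 1 : ℕ) : ℝ≥0∞) + 1) N
      rw [hs]
      refine le_trans ?_ (hu x h)
      simp only [Nat.cast_zero, mul_zero, zero_add, mul_one]
      gcongr with y
      calc ∑ n ∈ Finset.range N, (2 * ((n + 1 : ℕ) : ℝ≥0∞) + 1) * c.surv z n y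
          = ∑ n ∈ Finset.range N, (2 * (n : ℝ≥0∞) + 1) * c.surv z n y +
              2 * ∑ n ∈ Finset.range N, c.surv z n y := by
            rw [Finset.mul_sum, ← Finset.sum_add_distrib]
            refine Finset.sum_congr rfl fun n _ => ?_
            push_cast
            ring
        _ ≤ _ := by
            gcongr
            · exact ih y
            · rw [ET_eq_tsum]
              exact ENNReal.sum_le_tsum _

theorem ET_le_ET_add_ET (x z w : I) : c.ET x w ≤ c.ET x z + c.ET z w := by
  refine (c.ET_le_of_supersolution
    (u := fun y => min (c.ET y w) (c.ET y z + c.ET z w)) (fun y hy => le_min ?_ ?_) x).trans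
      (min_le_right _ _)
  · rw [ET_eq_one_add c hy]
    gcongr
    exact min_le_left _ _
  · by_cases hyz : y = z
    · subst hyz
      rw [ET_self, zero_add, ET_eq_one_add c hy]
      gcongr
      exact min_le_left _ _
    · rw [ET_eq_one_add c hyz, add_assoc]
      gcongr
      calc _ ≤ ∑' y', c.P y y' * (c.ET y' z + c.ET z w) := by
            gcongr
            exact min_le_right _ _
        _ = _ := by
            simp_rw [mul_add]
            rw [ENNReal.summable.tsum_add ENNReal.summable, tsum_P_mul_const]

/-- Kac-type bound coming from reversibility: the mean hitting time of `z` after one step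
from `z` is finite. -/
theorem invm_mul_tsum_P_mul_ET_le_one (z : I) :
    c.invm z * ∑' y, c.P z y * c.ET y z ≤ 1 := by
  set m : ℕ → ℝ≥0∞ := fun n => ∑' x, c.invm x * c.surv z n x
  set r : ℕ → ℝ≥0∞ := fun n => ∑' y, c.invm z * (c.P z y * c.surv z n y)
  have hstep : ∀ n, m (n + 1) + r n = m n := by
    intro n
    have h1 : m (n + 1) + r n =
        ∑' x, c.invm x * ∑' y, c.P x y * c.surv z n y := by
      rw [← ENNReal.summable.tsum_add_tsum_compl (s := {z}) ENNReal.summable, add_comm]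
      congr 1
      · simp [r, ENNReal.tsum_mul_left]
      · change ∑' x, c.invm x * c.surv z (n + 1) x = _
        rw [← ENNReal.summable.tsum_add_tsum_compl (s := {z}) ENNReal.summable]
        rw [tsum_singleton z fun x => c.invm x * c.surv z (n + 1) x, surv_self, mul_zero, zero_add]
        exact tsum_congr fun x => by rw [surv_succ c x.2]
    rw [h1]
    simp_rw [← ENNReal.tsum_mul_left]
    rw [ENNReal.tsum_comm]
    refine tsum_congr fun y => ?_
    calc ∑' x, c.invm x * (c.P x y * c.surv z n y)
        = ∑' x, c.P y x * (c.invm y * c.surv z n y) :=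
          tsum_congr fun x => by rw [← mul_assoc, c.invm_rev x y]; ring
      _ = _ := c.tsum_P_mul_const y _
  have hsum : ∀ N, ∑ n ∈ Finset.range N, r n + m N = m 0 := by
    intro N
    induction N with
    | zero => simp
    | succ N ih => rw [Finset.sum_range_succ, add_assoc, add_comm (r N), hstep, ih]
  have hm0 : m 0 ≤ 1 := by
    rw [← c.invm_sum]
    exact ENNReal.tsum_le_tsum fun x => mul_le_of_le_one_right' (c.surv_le_one z 0 x)
  calc c.invm z * ∑' y, c.P z y * c.ET y z = ∑' n, r n := by
        simp only [ET_eq_tsum, r, ← ENNReal.tsum_mul_left]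
        rw [ENNReal.tsum_comm]
    _ ≤ 1 := ENNReal.tsum_le_of_sum_range_le fun N =>
        le_self_add.trans ((hsum N).trans_le hm0)

theorem tsum_P_mul_ET_root_ne_top (x : I) (hx : c.ET x c.root ≠ ⊤) :
    ∑' y, c.P x y * c.ET y c.root ≠ ⊤ := by
  by_cases h : x = c.root
  · subst h
    intro htop
    have := c.invm_mul_tsum_P_mul_ET_le_one c.root
    rw [htop, ENNReal.mul_top (c.invm_pos _)] at this
    simp at this
  · rw [ET_eq_one_add c h] at hx
    exact (ENNReal.add_ne_top.1 hx).2

/-- Positive recurrence: the mean hitting times of the root are finite. -/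
theorem ET_root_ne_top (x : I) : c.ET x c.root ≠ ⊤ := by
  induction hd : c.depth x generalizing x with
  | zero => simp [c.depth_eq_zero x hd, ET_self]
  | succ d ih =>
    have hx : x ≠ c.root := by
      rintro rfl
      simp [c.depth_root] at hd
    have hpar := ih (c.par x) (by have := c.depth_par x hx; omega)
    exact c.ET_ne_top_of_tsum_ne_top (c.tsum_P_mul_ET_root_ne_top _ hpar) (c.lam_pos x hx)

theorem surv_par_le_of_mem_branch {x : I} (hx : x ≠ c.root) (n : ℕ) {y : I}
    (hy : y ∈ c.branch x) : c.surv c.root n (c.par x) ≤ c.surv c.root n y := by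
  induction n generalizing y with
  | zero =>
    rw [surv_zero c (c.ne_root_of_mem_branch hx hy)]
    exact c.surv_le_one _ _ _
  | succ n ih =>
    rw [surv_succ c (c.ne_root_of_mem_branch hx hy)]
    calc c.surv c.root (n + 1) (c.par x) ≤ c.surv c.root n (c.par x) := c.surv_succ_le _ _ _
      _ = ∑' y', c.P y y' * c.surv c.root n (c.par x) := (c.tsum_P_mul_const _ _).symm
      _ ≤ _ := by
        refine ENNReal.tsum_le_tsum fun y' => ?_
        by_cases hP : c.P y y' = 0
        · simp [hP]
        · gcongr
          rcases c.mem_branch_or_eq_par_of_P_ne_zero hy hP with h | h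
          · exact ih h
          · rw [h]

theorem ET_par_le_ET {x : I} (hx : x ≠ c.root) : c.ET (c.par x) c.root ≤ c.ET x c.root := by
  rw [ET_eq_tsum, ET_eq_tsum]
  exact ENNReal.tsum_le_tsum fun n => c.surv_par_le_of_mem_branch hx n (c.mem_branch_self x)

theorem sq_add_sq_le_sq_add_two_mul {s t k : ℝ≥0∞} (ht : t ≠ ⊤) (h1 : t ≤ s) (h2 : s ≤ k + t) :
    s ^ 2 + t ^ 2 ≤ k ^ 2 + 2 * s * t := by
  obtain ⟨e, rfl⟩ := exists_add_of_le h1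
  have he : e ≤ k := by
    rw [add_comm k] at h2
    exact (ENNReal.add_le_add_iff_left ht).1 h2
  calc (t + e) ^ 2 + t ^ 2 = e ^ 2 + 2 * (t + e) * t := by ring
    _ ≤ _ := by gcongr

/-- If the mean hitting times of the root increase by at most `k` along the edges of a branch,
the variance of the hitting time is at most `k ^ 2` times its mean on that branch. -/
theorem ET2_root_le {x : I} (hx : x ≠ c.root) (hpar : c.par x = c.root) {k : ℝ≥0∞}
    (hk : ∀ b ∈ c.branch x, c.ET b (c.par b) ≤ k) {y : I} (hy : y ∈ c.branch x) :
    c.ET2 y c.root ≤ c.ET y c.root ^ 2 + k ^ 2 * c.ET y c.root := by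
  classical
  let h : I → ℝ≥0∞ := fun y => c.ET y c.root
  let u : I → ℝ≥0∞ := fun y =>
    if y ∈ c.branch x ∨ y = c.root then h y ^ 2 + k ^ 2 * h y else ⊤
  have hfin : ∀ y, h y ≠ ⊤ := c.ET_root_ne_top
  suffices hu : ∀ y, y ≠ c.root → 1 + ∑' y', c.P y y' * (u y' + 2 * h y') ≤ u y by
    have := c.ET2_le_of_supersolution hu y
    rwa [show u y = _ from if_pos (Or.inl hy)] at this
  clear! y
  intro y hy0
  by_cases hy : y ∈ c.branch x
  swap
  · rw [show u y = ⊤ from if_neg (by tauto)]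
    exact le_top
  rw [show u y = _ from if_pos (Or.inl hy)]
  have hedge : ∀ b ∈ c.branch x, h b ^ 2 + h (c.par b) ^ 2 ≤ k ^ 2 + 2 * h b * h (c.par b) :=
    fun b hb => sq_add_sq_le_sq_add_two_mul (hfin _)
      (c.ET_par_le_ET (c.ne_root_of_mem_branch hx hb))
      ((c.ET_le_ET_add_ET b (c.par b) c.root).trans (by gcongr; exact hk b hb))
  have hinc : ∀ y', c.P y y' ≠ 0 → h y' ^ 2 + h y ^ 2 ≤ k ^ 2 + 2 * h y * h y' := by
    intro y' hP
    rcases c.P_support y y' hP with rfl | rfl | rfl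
    · calc h y' ^ 2 + h y' ^ 2 = 2 * h y' * h y' := by ring
        _ ≤ _ := le_add_self
    · rw [add_comm]
      exact hedge y hy
    · calc _ ≤ _ := hedge y' (c.mem_branch_of_par_mem hy)
        _ = _ := by ring
  set m := ∑' y', c.P y y' * h y' with hm
  set S := ∑' y', c.P y y' * h y' ^ 2 with hS
  have hhy : h y = 1 + m := c.ET_eq_one_add hy0
  have hmul : S + h y ^ 2 ≤ k ^ 2 + 2 * h y * m := by
    have hR : k ^ 2 + 2 * h y * m = ∑' y', c.P y y' * (k ^ 2 + 2 * h y * h y') := by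
      simp_rw [mul_add]
      rw [ENNReal.summable.tsum_add ENNReal.summable, tsum_P_mul_const, hm,
        ← ENNReal.tsum_mul_left]
      congr 1
      exact tsum_congr fun y' => by ring
    have hL : S + h y ^ 2 = ∑' y', c.P y y' * (h y' ^ 2 + h y ^ 2) := by
      simp_rw [mul_add]
      rw [ENNReal.summable.tsum_add ENNReal.summable, tsum_P_mul_const]
    rw [hR, hL]
    refine ENNReal.tsum_le_tsum fun y' => ?_
    by_cases hP : c.P y y' = 0
    · simp [hP]
    · gcongr c.P y y' * ?_
      exact hinc y' hP
  have hLHS : ∑' y', c.P y y' * (u y' + 2 * h y') = S + k ^ 2 * m + 2 * m := by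
    have : ∀ y', c.P y y' * (u y' + 2 * h y') =
        c.P y y' * h y' ^ 2 + k ^ 2 * (c.P y y' * h y') + 2 * (c.P y y' * h y') := by
      intro y'
      by_cases hP : c.P y y' = 0
      · simp [hP]
      · have hmem := c.mem_branch_or_eq_par_of_P_ne_zero hy hP
        rw [hpar] at hmem
        rw [show u y' = _ from if_pos hmem]
        ring
    simp_rw [this]
    rw [ENNReal.summable.tsum_add ENNReal.summable, ENNReal.summable.tsum_add ENNReal.summable,
      ENNReal.tsum_mul_left, ENNReal.tsum_mul_left]
  rw [hLHS, ← ENNReal.add_le_add_iff_left (ENNReal.pow_ne_top (n := 2) (hfin y))]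
  calc h y ^ 2 + (1 + (S + k ^ 2 * m + 2 * m))
      = (S + h y ^ 2) + (1 + k ^ 2 * m + 2 * m) := by ring
    _ ≤ (k ^ 2 + 2 * h y * m) + (1 + k ^ 2 * m + 2 * m) := by gcongr
    _ ≤ (k ^ 2 + 2 * h y * m) + (1 + k ^ 2 * m + 2 * m) + 1 := le_self_add
    _ = h y ^ 2 + (h y ^ 2 + k ^ 2 * h y) := by
        rw [hhy]
        ring

theorem one_le_ET_root {x : I} (hx : x ≠ c.root) : 1 ≤ c.ET x c.root := by
  rw [ET_eq_one_add c hx]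
  exact le_self_add

/-- Second moment bound for the hitting time of the root in terms of the drift constant. -/
theorem ET2_root_le_Kdrift {a : I} (ha : 1 ≤ c.depth a) {κ : ℝ≥0∞} (hκ : 0 < κ)
    (hmu : ∀ b ∈ c.branch (c.alphaVert a), κ ≤ c.mu b) :
    c.ET2 a c.root ≤
      c.ET a c.root ^ 2 + (c.Kdrift a / κ) ^ 2 * c.ET a c.root := by
  have hα1 := c.depth_alphaVert ha
  have hα : c.alphaVert a ≠ c.root := by
    intro h
    rw [h, c.depth_root] at hα1
    omega
  have hpar : c.par (c.alphaVert a) = c.root :=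
    c.depth_eq_zero _ (by have := c.depth_par _ hα; omega)
  have hκt : κ ≠ ⊤ :=
    ((hmu _ (c.mem_branch_self _)).trans (c.mu_le_one _)).trans_lt ENNReal.one_lt_top |>.ne
  refine c.ET2_root_le hα hpar (fun b hb => ?_) ⟨_, rfl⟩
  rw [ENNReal.le_div_iff_mul_le (Or.inl hκ.ne') (Or.inl hκt)]
  calc c.ET b (c.par b) * κ ≤ c.mu b * c.ET b (c.par b) := by
        rw [mul_comm]
        gcongr
        exact hmu b hb
    _ ≤ c.Kdrift a := le_iSup₂_of_le (f := fun b _ => c.mu b * c.ET b (c.par b)) b hb le_rfl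

theorem memLp_ratio {x y : I} (h : c.ET2 x y ≠ ⊤) : MemLp (c.ratio x y) 2 (c.law x) := by
  have hm : Measurable (c.ratio x y) := (measurable_hitTime y).ennreal_toReal.div_const _
  rw [memLp_two_iff_integrable_sq hm.aestronglyMeasurable]
  have := (integrable_toReal_of_lintegral_ne_top
    ((measurable_hitTime y).pow_const 2).aemeasurable h).div_const ((c.ET x y).toReal ^ 2)
  refine this.congr (ae_of_all _ fun ω => ?_)
  simp only [ratio, div_pow, ENNReal.toReal_pow]

theorem integral_ratio {x y : I} (h0 : c.ET x y ≠ 0) (h : c.ET x y ≠ ⊤) :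
    ∫ ω, c.ratio x y ω ∂c.law x = 1 := by
  simp only [ratio]
  rw [integral_div, integral_toReal (measurable_hitTime y).aemeasurable
    (ae_lt_top (measurable_hitTime y) h)]
  exact div_self (ENNReal.toReal_ne_zero.2 ⟨h0, h⟩)

theorem integral_ratio_sq {x y : I} (h : c.ET2 x y ≠ ⊤) :
    ∫ ω, c.ratio x y ω ^ 2 ∂c.law x = (c.ET2 x y).toReal / (c.ET x y).toReal ^ 2 := by
  simp only [ratio, div_pow, ← ENNReal.toReal_pow]
  rw [integral_div, integral_toReal ((measurable_hitTime y).pow_const 2).aemeasurable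
    (ae_lt_top ((measurable_hitTime y).pow_const 2) h)]
  rfl

theorem variance_ratio_le {x y : I} (h0 : c.ET x y ≠ 0) (h : c.ET x y ≠ ⊤) {v : ℝ≥0∞}
    (hv : v ≠ ⊤) (h2 : c.ET2 x y ≤ c.ET x y ^ 2 + v * c.ET x y) :
    variance (c.ratio x y) (c.law x) ≤ (v / c.ET x y).toReal := by
  have := c.law_prob x
  have hbound : c.ET x y ^ 2 + v * c.ET x y ≠ ⊤ :=
    ENNReal.add_ne_top.2 ⟨ENNReal.pow_ne_top h, ENNReal.mul_ne_top hv h⟩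
  have hET2 : c.ET2 x y ≠ ⊤ := ne_top_of_le_ne_top hbound h2
  have hpos : 0 < (c.ET x y).toReal := ENNReal.toReal_pos h0 h
  have h2' : (c.ET2 x y).toReal ≤ (c.ET x y).toReal ^ 2 + v.toReal * (c.ET x y).toReal := by
    have := ENNReal.toReal_mono hbound h2
    rwa [ENNReal.toReal_add (ENNReal.pow_ne_top h) (ENNReal.mul_ne_top hv h), ENNReal.toReal_pow,
      ENNReal.toReal_mul] at this
  rw [variance_eq_sub (c.memLp_ratio hET2), c.integral_ratio h0 h, ENNReal.toReal_div]
  simp only [Pi.pow_apply]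
  rw [c.integral_ratio_sq hET2, one_pow, sub_le_iff_le_add, div_le_iff₀ (by positivity)]
  refine h2'.trans (le_of_eq ?_)
  field_simp
  ring

end FirstStep

end TreeChain

/-- **Proposition 1** (cut-off): under the `0^ℓ-SD` condition,
`Var(T^a_0/E[T^a_0]) → 0`, and consequently `T^a_0/E[T^a_0] → 1` in probability. -/
theorem cutoff_of_strongDrift {I : ℕ → Type*} [∀ n, MeasurableSpace (I n)]
    [∀ n, Countable (I n)] (c : ∀ n, TreeChain (I n)) (a : ∀ n, I n)
    (hdepth : Tendsto (fun n => (c n).depth (a n)) atTop atTop)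
    (hSD : StrongDrift c a) :
    Tendsto (fun n =>
        variance (fun ω => (c n).ratio (a n) (c n).root ω) ((c n).law (a n)))
      atTop (𝓝 0) ∧
    ∀ ε : ℝ, 0 < ε →
      Tendsto (fun n =>
          ((c n).law (a n)) {ω | ε ≤ |(c n).ratio (a n) (c n).root ω - 1|})
        atTop (𝓝 0) := by
  obtain ⟨⟨κ, hκ, hmu⟩, hK⟩ := hSD
  set v : ℕ → ℝ≥0∞ := fun n => ((c n).Kdrift (a n) / κ) ^ 2 with hv
  set h : ℕ → ℝ≥0∞ := fun n => (c n).ET (a n) (c n).root with hh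
  have hlim : Tendsto (fun n => v n / h n) atTop (𝓝 0) := by
    have := ENNReal.Tendsto.const_mul (a := (κ⁻¹) ^ 2) hK
      (Or.inr (ENNReal.pow_ne_top (ENNReal.inv_ne_top.2 hκ.ne')))
    rw [mul_zero] at this
    refine this.congr fun n => ?_
    simp only [hv, hh, div_eq_mul_inv]
    ring
  have hlim' : Tendsto (fun n => (v n / h n).toReal) atTop (𝓝 0) := by
    exact (ENNReal.tendsto_toReal ENNReal.zero_ne_top).comp hlim
  have hev : ∀ᶠ n in atTop, (c n).ET2 (a n) (c n).root ≠ ⊤ ∧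
      ∫ ω, (c n).ratio (a n) (c n).root ω ∂(c n).law (a n) = 1 ∧
      variance ((c n).ratio (a n) (c n).root) ((c n).law (a n)) ≤ (v n / h n).toReal := by
    filter_upwards [hdepth.eventually_ge_atTop 1, hlim.eventually_lt_const ENNReal.zero_lt_top]
      with n hd hvn
    have := TreeChain.measurableSingletonClass (c n)
    have ha : a n ≠ (c n).root := by
      intro h0
      rw [h0, (c n).depth_root] at hd
      omega
    have hT : h n ≠ ⊤ := (c n).ET_root_ne_top (a n)
    have h0 : h n ≠ 0 := (zero_lt_one.trans_le ((c n).one_le_ET_root ha)).ne'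
    have hvt : v n ≠ ⊤ := by
      intro h1
      rw [h1, ENNReal.top_div_of_ne_top hT] at hvn
      exact hvn.ne rfl
    have h2 := (c n).ET2_root_le_Kdrift hd hκ (hmu n)
    exact ⟨ne_top_of_le_ne_top (ENNReal.add_ne_top.2
      ⟨ENNReal.pow_ne_top hT, ENNReal.mul_ne_top hvt hT⟩) h2, (c n).integral_ratio h0 hT,
      (c n).variance_ratio_le h0 hT hvt h2⟩
  have hvar : Tendsto (fun n =>
      variance (fun ω => (c n).ratio (a n) (c n).root ω) ((c n).law (a n))) atTop (𝓝 0) :=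
    tendsto_of_tendsto_of_tendsto_of_le_of_le' tendsto_const_nhds hlim'
      (Eventually.of_forall fun n => variance_nonneg _ _) (hev.mono fun n hn => hn.2.2)
  refine ⟨hvar, fun ε hε => ?_⟩
  have hcheb : Tendsto (fun n => ENNReal.ofReal
      (variance (fun ω => (c n).ratio (a n) (c n).root ω) ((c n).law (a n)) / ε ^ 2))
      atTop (𝓝 0) := by
    simpa using ENNReal.tendsto_ofReal (hvar.div_const (ε ^ 2))
  refine tendsto_of_tendsto_of_tendsto_of_le_of_le' tendsto_const_nhds hcheb
    (Eventually.of_forall fun n => zero_le) (hev.mono fun n hn => ?_)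
  have := (c n).law_prob (a n)
  have := TreeChain.measurableSingletonClass (c n)
  have hmeas := meas_ge_le_variance_div_sq ((c n).memLp_ratio hn.1) hε
  rwa [hn.2.1] at hmeas
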